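/- Let p ∈ (1,∞), σ ∈ (0,2), and let ν be a Borel measure on ℝ^d with ν(B_r^c) ≤ Λ r^{-σ} for all r > 0. For j ∈ ℤ and κ ∈ (0,1), define the averaged operator T_κ^j u(x) = ⨍_{B_{κ2^j}^c, μ} ⨍_{B_{2^{j+1}}} |u(x+y+z)| dz dμ(y), where μ(dy) = ν(dy) + |y|^{−d−σ}dy and ⨍_{B_{κ2^j}^c,μ} denotes μ-average over {|y| > κ2^j}. Then the maximal operator T u = sup_{j∈ℤ} T_κ^j u satisfies ‖T u‖_{L_p(ℝ^d)} ≤ N(d, p, σ, Λ) ‖u‖_{L_p(ℝ^d)}, with N independent of κ. -/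

import Mathlib

open MeasureTheory Metric Set
open scoped ENNReal

noncomputable section

/-- The layer-cake formula for a single extended nonnegative number. -/
lemma setLIntegral_Ioi_indicator_rpow {q : ℝ} (hq : 0 < q) (a : ℝ≥0∞) :
    ∫⁻ t in Ioi (0 : ℝ), {t : ℝ | ENNReal.ofReal t < a}.indicator
      (fun t ↦ ENNReal.ofReal (t ^ (q - 1))) t = a ^ q / ENNReal.ofReal q := by
  have key (b : ℝ) (hb : 0 ≤ b) :
      ∫⁻ t in Ioi (0 : ℝ), {t : ℝ | ENNReal.ofReal t < ENNReal.ofReal b}.indicator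
        (fun t ↦ ENNReal.ofReal (t ^ (q - 1))) t
        = ENNReal.ofReal b ^ q / ENNReal.ofReal q := by
    have hset : {t : ℝ | ENNReal.ofReal t < ENNReal.ofReal b} ∩ Ioi 0 = Ioo 0 b := by
      ext t
      simp only [mem_inter_iff, mem_ofPred_eq, mem_Ioi, mem_Ioo]
      constructor
      · rintro ⟨h1, h2⟩
        exact ⟨h2, ((ENNReal.ofReal_lt_ofReal_iff_of_nonneg h2.le).1 h1)⟩
      · rintro ⟨h1, h2⟩
        exact ⟨(ENNReal.ofReal_lt_ofReal_iff_of_nonneg h1.le).2 h2, h1⟩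
    have hm : MeasurableSet {t : ℝ | ENNReal.ofReal t < ENNReal.ofReal b} :=
      measurableSet_lt ENNReal.measurable_ofReal measurable_const
    rw [lintegral_indicator hm, Measure.restrict_restrict hm, hset,
      restrict_Ioo_eq_restrict_Ioc, ← ofReal_integral_eq_lintegral_ofReal,
      ← intervalIntegral.integral_of_le hb, integral_rpow (Or.inl (by linarith)),
      sub_add_cancel, Real.zero_rpow hq.ne', sub_zero, ENNReal.ofReal_div_of_pos hq,
      ENNReal.ofReal_rpow_of_nonneg hb hq.le]
    · rw [← IntegrableOn, ← intervalIntegrable_iff_integrableOn_Ioc_of_le hb]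
      exact intervalIntegral.intervalIntegrable_rpow' (by linarith)
    · filter_upwards [ae_restrict_mem measurableSet_Ioc] with t ht
      exact Real.rpow_nonneg ht.1.le _
  induction a with
  | coe a => simpa using key a a.2
  | top =>
    rw [ENNReal.top_rpow_of_pos hq, ENNReal.top_div_of_ne_top ENNReal.ofReal_ne_top, eq_top_iff]
    refine ENNReal.le_of_forall_nnreal_lt fun r _ ↦ ?_
    have hr : 0 ≤ (q * r) ^ q⁻¹ := by positivity
    have h := key ((q * r) ^ q⁻¹) hr
    rw [ENNReal.ofReal_rpow_of_nonneg hr hq.le, Real.rpow_inv_rpow (by positivity) hq.ne',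
      ← ENNReal.ofReal_div_of_pos hq, mul_div_cancel_left₀ _ hq.ne',
      ENNReal.ofReal_coe_nnreal] at h
    rw [← h]
    refine lintegral_mono fun t ↦ indicator_le_indicator_of_subset ?_ (fun _ ↦ zero_le) t
    exact fun t _ ↦ by simp

lemma measurable_indicator_ofReal_lt {Z : Type*} [MeasurableSpace Z] {g : Z → ℝ≥0∞}
    (hg : Measurable g) (q : ℝ) :
    Measurable (fun z : Z × ℝ ↦ {t : ℝ | ENNReal.ofReal t < g z.1}.indicator
      (fun t ↦ ENNReal.ofReal (t ^ q)) z.2) := by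
  have : MeasurableSet {z : Z × ℝ | ENNReal.ofReal z.2 < g z.1} :=
    measurableSet_lt (by fun_prop) (by fun_prop)
  exact Measurable.indicator (f := fun z : Z × ℝ ↦ ENNReal.ofReal (z.2 ^ q)) (by fun_prop) this

/-- Real interpolation between a weak-type `(1,1)` bound and an `L^∞` bound. -/
lemma lintegral_rpow_le_of_measure_lt_le {X Y : Type*} [MeasurableSpace X] [MeasurableSpace Y]
    {μ : Measure X} {ν : Measure Y} [SFinite μ] [SFinite ν] {S : X → ℝ≥0∞} {f : Y → ℝ≥0∞}
    (hS : Measurable S) (hf : Measurable f) {K : ℝ≥0∞} {p : ℝ} (hp : 1 < p)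
    (h : ∀ t : ℝ, 0 < t → μ {x | ENNReal.ofReal t < S x} ≤
      K * (ENNReal.ofReal t)⁻¹ * ∫⁻ y in {y | ENNReal.ofReal t < 2 * f y}, f y ∂ν) :
    ∫⁻ x, S x ^ p ∂μ ≤
      ENNReal.ofReal p * K * 2 ^ (p - 1) / ENNReal.ofReal (p - 1) * ∫⁻ y, f y ^ p ∂ν := by
  have hp0 : 0 < p := by linarith
  have hp1 : 0 < p - 1 := by linarith
  have hpo : ENNReal.ofReal p ≠ 0 := by simpa using hp0
  have hrepr (x : X) : S x ^ p = ENNReal.ofReal p * ∫⁻ t in Ioi (0 : ℝ),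
      {t : ℝ | ENNReal.ofReal t < S x}.indicator (fun t ↦ ENNReal.ofReal (t ^ (p - 1))) t := by
    rw [setLIntegral_Ioi_indicator_rpow hp0, ENNReal.mul_div_cancel hpo ENNReal.ofReal_ne_top]
  have h2f : Measurable fun y ↦ 2 * f y := by fun_prop
  calc ∫⁻ x, S x ^ p ∂μ
      = ENNReal.ofReal p * ∫⁻ t in Ioi (0 : ℝ),
          ∫⁻ x, {t : ℝ | ENNReal.ofReal t < S x}.indicator
            (fun t ↦ ENNReal.ofReal (t ^ (p - 1))) t ∂μ := by
        simp_rw [hrepr]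
        rw [lintegral_const_mul _ ((measurable_indicator_ofReal_lt hS _).lintegral_prod_right'),
          lintegral_lintegral_swap (measurable_indicator_ofReal_lt hS _).aemeasurable]
    _ = ENNReal.ofReal p * ∫⁻ t in Ioi (0 : ℝ),
          ENNReal.ofReal (t ^ (p - 1)) * μ {x | ENNReal.ofReal t < S x} := by
        congr 2 with t
        rw [← lintegral_indicator_const (measurableSet_lt measurable_const hS)]
        rfl
    _ ≤ ENNReal.ofReal p * ∫⁻ t in Ioi (0 : ℝ), K * ∫⁻ y,
          f y * {t : ℝ | ENNReal.ofReal t < 2 * f y}.indicator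
            (fun t ↦ ENNReal.ofReal (t ^ (p - 1 - 1))) t ∂ν := by
        gcongr ENNReal.ofReal p * ?_
        refine setLIntegral_mono' measurableSet_Ioi fun t ht ↦ ?_
        have ht : 0 < t := ht
        have hfac : ENNReal.ofReal (t ^ (p - 1 - 1)) =
            ENNReal.ofReal (t ^ (p - 1)) * (ENNReal.ofReal t)⁻¹ := by
          rw [Real.rpow_sub_one ht.ne', ENNReal.ofReal_div_of_pos ht, div_eq_mul_inv]
        calc ENNReal.ofReal (t ^ (p - 1)) * μ {x | ENNReal.ofReal t < S x}
            ≤ ENNReal.ofReal (t ^ (p - 1)) * (K * (ENNReal.ofReal t)⁻¹ *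
                ∫⁻ y in {y | ENNReal.ofReal t < 2 * f y}, f y ∂ν) := by
              gcongr
              exact h t ht
          _ = K * (ENNReal.ofReal (t ^ (p - 1 - 1)) *
                ∫⁻ y in {y | ENNReal.ofReal t < 2 * f y}, f y ∂ν) := by
              rw [hfac]; ring
          _ = _ := by
              rw [← lintegral_const_mul _ hf, ← lintegral_indicator (measurableSet_lt measurable_const h2f)]
              congr 2 with y
              by_cases hy : ENNReal.ofReal t < 2 * f y <;> simp [indicator, mul_comm]
    _ = ENNReal.ofReal p * K * ∫⁻ y, f y * ∫⁻ t in Ioi (0 : ℝ),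
          {t : ℝ | ENNReal.ofReal t < 2 * f y}.indicator
            (fun t ↦ ENNReal.ofReal (t ^ (p - 1 - 1))) t ∂volume ∂ν := by
        have hm : Measurable fun z : Y × ℝ ↦ f z.1 * {t : ℝ | ENNReal.ofReal t < 2 * f z.1}.indicator
            (fun t ↦ ENNReal.ofReal (t ^ (p - 1 - 1))) z.2 :=
          (hf.comp measurable_fst).mul (measurable_indicator_ofReal_lt h2f _)
        rw [lintegral_const_mul _ (hm.lintegral_prod_left'), ← mul_assoc,
          ← lintegral_lintegral_swap (f := fun y t ↦ f y * {t : ℝ | ENNReal.ofReal t < 2 * f y}.indicator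
            (fun t ↦ ENNReal.ofReal (t ^ (p - 1 - 1))) t) hm.aemeasurable]
        congr 2 with y
        rw [lintegral_const_mul]
        exact (measurable_indicator_ofReal_lt h2f (p - 1 - 1)).comp measurable_prodMk_left
    _ = _ := by
        rw [← lintegral_const_mul _ (hf.pow_const p), ← lintegral_const_mul _ (by
          simp_rw [setLIntegral_Ioi_indicator_rpow hp1]; fun_prop)]
        congr 1 with y
        rw [setLIntegral_Ioi_indicator_rpow hp1, ENNReal.mul_rpow_of_nonneg _ _ hp1.le]
        have : f y ^ p = f y * f y ^ (p - 1) := by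
          conv_rhs => enter [1]; rw [← ENNReal.rpow_one (f y)]
          rw [← ENNReal.rpow_add_of_nonneg _ _ zero_le_one hp1.le]
          ring_nf
        rw [this]
        simp only [div_eq_mul_inv]
        ring

/-- The Jensen inequality for powers of an extended nonnegative function. -/
lemma lintegral_rpow_le_lintegral_rpow {X : Type*} [MeasurableSpace X] {Q : Measure X}
    [IsProbabilityMeasure Q] {g : X → ℝ≥0∞} (hg : AEMeasurable g Q) {p : ℝ} (hp : 1 < p) :
    (∫⁻ x, g x ∂Q) ^ p ≤ ∫⁻ x, g x ^ p ∂Q := by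
  have h := ENNReal.lintegral_mul_le_Lp_mul_Lq Q (Real.HolderConjugate.conjExponent hp) hg
    (g := 1) aemeasurable_const
  simp only [Pi.mul_apply, Pi.one_apply, mul_one, ENNReal.one_rpow, lintegral_one,
    measure_univ] at h
  refine (ENNReal.rpow_le_rpow h (by linarith)).trans_eq ?_
  rw [← ENNReal.rpow_mul, one_div_mul_cancel (by linarith), ENNReal.rpow_one]

section ShiftedMaximal

variable {E : Type*} [NormedAddCommGroup E] [MeasurableSpace E] (m : Measure E)

/-- The average of `f` over the ball of radius `r` centered at `x`. -/
def ballAverage (r : ℝ) (f : E → ℝ≥0∞) (x : E) : ℝ≥0∞ :=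
  (m (ball 0 r))⁻¹ * ∫⁻ z in ball 0 r, f (x + z) ∂m

/-- The dyadic maximal function whose average at scale `2 ^ (j + 1)` is centered at the shifted
point `x + ω j`. -/
def shiftedMaximal (f : E → ℝ≥0∞) (ω : ℤ → E) (x : E) : ℝ≥0∞ :=
  ⨆ j : ℤ, ballAverage m ((2 : ℝ) ^ (j + 1)) f (x + ω j)

variable {m}

lemma ballAverage_mono {f g : E → ℝ≥0∞} (h : ∀ x, f x ≤ g x) (r : ℝ) (x : E) :
    ballAverage m r f x ≤ ballAverage m r g x := by
  unfold ballAverage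
  gcongr
  exact h _

lemma ballAverage_add_const_le (f : E → ℝ≥0∞) (c : ℝ≥0∞) (r : ℝ) (x : E) :
    ballAverage m r (fun y ↦ f y + c) x ≤ ballAverage m r f x + c := by
  unfold ballAverage
  rw [lintegral_add_right _ measurable_const, mul_add]
  gcongr
  rw [setLIntegral_const, mul_comm c, ← mul_assoc]
  exact mul_le_of_le_one_left' (ENNReal.inv_mul_le_one _)

lemma lintegral_cond_ballAverage [m.IsOpenPosMeasure] (μ : Measure E) {r : ℝ} (hr : 0 < r) (S : Set E)
    (f : E → ℝ≥0∞) (x : E) :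
    ∫⁻ y, ballAverage m r f (x + y) ∂(ProbabilityTheory.cond μ S) =
      (μ S)⁻¹ * (m (ball 0 r))⁻¹ * ∫⁻ y in S, ∫⁻ z in ball 0 r, f (x + y + z) ∂m ∂μ := by
  unfold ballAverage ProbabilityTheory.cond
  rw [lintegral_smul_measure, smul_eq_mul,
    lintegral_const_mul' _ _ (ENNReal.inv_ne_top.2 (measure_ball_pos m _ hr).ne'), mul_assoc]

variable [BorelSpace E] [m.IsAddHaarMeasure]

lemma lt_mul_lintegral_of_lt_ballAverage {f : E → ℝ≥0∞} {r : ℝ} {x : E} {t : ℝ≥0∞}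
    (h : t < ballAverage m r f x) : t * m (ball x r) ≤ ∫⁻ y in ball x r, f y ∂m := by
  have h1 : ∫⁻ y in ball x r, f y ∂m = ∫⁻ z in ball 0 r, f (x + z) ∂m := by
    rw [← (measurePreserving_add_left m x).setLIntegral_comp_preimage_emb
      (measurableEmbedding_addLeft x)]
    congr 2
    ext z
    simp
  rw [h1, Measure.addHaar_ball_center]
  unfold ballAverage at h
  rw [mul_comm, ← div_eq_mul_inv] at h
  exact ENNReal.mul_le_of_le_div h.le

variable [NormedSpace ℝ E] [FiniteDimensional ℝ E]

lemma measurable_ballAverage {f : E → ℝ≥0∞} (hf : Measurable f) (r : ℝ) :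
    Measurable (ballAverage m r f) := by
  have : Measurable fun q : E × E ↦ f (q.1 + q.2) := by fun_prop
  exact this.lintegral_prod_right'.const_mul _

lemma measurable_shiftedMaximal {f : E → ℝ≥0∞} (hf : Measurable f) :
    Measurable fun q : (ℤ → E) × E ↦ shiftedMaximal m f q.1 q.2 := by
  refine Measurable.iSup fun j ↦ (measurable_ballAverage hf _).comp ?_
  fun_prop

lemma exists_le_of_measure_ball_le [Nontrivial E] {I : ℝ≥0∞} (hI : I ≠ ∞) :
    ∃ R : ℝ, ∀ (x : E) (r : ℝ), 0 < r → m (ball x r) ≤ I → r ≤ R := by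
  have hV0 : m (ball 0 1) ≠ 0 := (measure_ball_pos m _ one_pos).ne'
  have hV : m (ball 0 1) ≠ ∞ := measure_ball_lt_top.ne
  refine ⟨max 1 (I / m (ball 0 1)).toReal, fun x r hr h ↦ ?_⟩
  rcases le_total r 1 with h1 | h1
  · exact le_max_of_le_left h1
  · refine le_max_of_le_right ?_
    rw [Measure.addHaar_ball m x hr.le] at h
    have h2 : ENNReal.ofReal (r ^ Module.finrank ℝ E) ≤ I / m (ball 0 1) :=
      (ENNReal.le_div_iff_mul_le (Or.inl hV0) (Or.inl hV)).2 h
    have h3 := (ENNReal.ofReal_le_iff_le_toReal (ENNReal.div_ne_top hI hV0)).1 h2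
    exact (le_self_pow₀ h1 Module.finrank_pos.ne').trans h3

/-- The measure of the points which some shift `ω (n - k)`, `k : ℕ`, moves into a given ball of
radius comparable to `2 ^ (n + 1)`. -/
lemma measure_exists_shift_mem_ball_le {Q : Measure (ℤ → E)} [IsProbabilityMeasure Q]
    {C θ : ℝ≥0∞} {n : ℤ}
    (hQ : ∀ k : ℕ, Q {ω | (2 : ℝ) ^ (n + 1) < ‖ω (n - k)‖} ≤ C * θ ^ k) (z : E) :
    (Q.prod m) {q | ∃ k : ℕ, q.2 + q.1 (n - k) ∈ ball z (2 * (2 : ℝ) ^ (n + 1))} ≤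
      (3 ^ Module.finrank ℝ E + 2 ^ Module.finrank ℝ E * (C * (1 - θ)⁻¹)) *
        m (ball z ((2 : ℝ) ^ (n + 1))) := by
  set r : ℝ := (2 : ℝ) ^ (n + 1)
  have hr0 : 0 < r := by positivity
  have hball (c : ℕ) (hc : 0 < c) (x : E) :
      m (ball x (c * r)) = c ^ Module.finrank ℝ E * m (ball z r) := by
    rw [Measure.addHaar_ball_mul_of_pos m x (by exact_mod_cast hc), Measure.addHaar_ball_center m z,
      ENNReal.ofReal_pow (by positivity), ENNReal.ofReal_natCast]
  let F (k : ℕ) : Set ((ℤ → E) × E) :=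
    {q | r < ‖q.1 (n - k)‖ ∧ q.2 + q.1 (n - k) ∈ ball z (2 * r)}
  have hF (k : ℕ) : (Q.prod m) (F k) ≤ C * θ ^ k * (2 ^ Module.finrank ℝ E * m (ball z r)) := by
    have hFm : MeasurableSet (F k) := by
      have h1 : MeasurableSet {q : (ℤ → E) × E | r < ‖q.1 (n - k)‖} :=
        measurableSet_lt (by fun_prop) (by fun_prop)
      have h2 : MeasurableSet {q : (ℤ → E) × E | q.2 + q.1 (n - k) ∈ ball z (2 * r)} :=
        measurableSet_ball.preimage (by fun_prop)
      exact h1.inter h2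
    rw [Measure.prod_apply hFm]
    have hfib (ω : ℤ → E) : m (Prod.mk ω ⁻¹' F k) ≤
        {ω : ℤ → E | r < ‖ω (n - k)‖}.indicator
          (fun _ ↦ 2 ^ Module.finrank ℝ E * m (ball z r)) ω := by
      by_cases hω : r < ‖ω (n - k)‖
      · rw [indicator_of_mem (by exact hω)]
        refine (measure_mono (t := ball (z - ω (n - k)) (2 * r)) fun x hx ↦ ?_).trans_eq
          (by exact_mod_cast hball 2 two_pos _)
        have := hx.2
        rw [mem_ball, dist_eq_norm] at this ⊢
        convert this using 2
        simp only []
        abel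
      · have : Prod.mk ω ⁻¹' F k = ∅ := by
          ext x
          simp [F, hω]
        simp [this]
    refine (lintegral_mono hfib).trans ?_
    rw [lintegral_indicator_const (measurableSet_lt (by fun_prop) (by fun_prop)), mul_comm]
    gcongr
    exact hQ k
  have hsub : {q : (ℤ → E) × E | ∃ k : ℕ, q.2 + q.1 (n - k) ∈ ball z (2 * r)} ⊆
      univ ×ˢ ball z (3 * r) ∪ ⋃ k, F k := by
    rintro ⟨ω, x⟩ ⟨k, hk⟩
    by_cases hω : r < ‖ω (n - k)‖
    · exact Or.inr (mem_iUnion.2 ⟨k, hω, hk⟩)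
    · refine Or.inl ⟨mem_univ _, ?_⟩
      simp only [mem_ball, dist_eq_norm] at hk ⊢
      calc ‖x - z‖ = ‖(x + ω (n - k) - z) - ω (n - k)‖ := by congr 1; abel
        _ ≤ ‖x + ω (n - k) - z‖ + ‖ω (n - k)‖ := norm_sub_le _ _
        _ < 3 * r := by linarith [not_lt.1 hω]
  calc _ ≤ (Q.prod m) (univ ×ˢ ball z (3 * r)) + ∑' k, (Q.prod m) (F k) :=
        (measure_mono hsub).trans ((measure_union_le _ _).trans (by
          gcongr; exact measure_iUnion_le _))
    _ ≤ 3 ^ Module.finrank ℝ E * m (ball z r) +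
          ∑' k : ℕ, C * θ ^ k * (2 ^ Module.finrank ℝ E * m (ball z r)) := by
        gcongr with k
        · rw [Measure.prod_prod, measure_univ, one_mul]
          exact_mod_cast (hball 3 three_pos z).le
        · exact hF k
    _ = _ := by
        rw [ENNReal.tsum_mul_right, ENNReal.tsum_mul_left, ENNReal.tsum_geometric]
        ring

/-- The weak-type `(1,1)` bound for the dyadic maximal function with random shifts. -/
lemma measure_lt_shiftedMaximal_le [Nontrivial E] {Q : Measure (ℤ → E)} [IsProbabilityMeasure Q]
    {C θ : ℝ≥0∞}
    (hQ : ∀ (n : ℤ) (k : ℕ), Q {ω | (2 : ℝ) ^ (n + 1) < ‖ω (n - k)‖} ≤ C * θ ^ k)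
    (f : E → ℝ≥0∞) {t : ℝ≥0∞} (ht0 : t ≠ 0) (ht : t ≠ ∞) :
    (Q.prod m) {q | t < shiftedMaximal m f q.1 q.2} ≤
      (3 ^ Module.finrank ℝ E + 2 ^ Module.finrank ℝ E * (C * (1 - θ)⁻¹)) * t⁻¹ *
        ∫⁻ x, f x ∂m := by
  set K : ℝ≥0∞ := 3 ^ Module.finrank ℝ E + 2 ^ Module.finrank ℝ E * (C * (1 - θ)⁻¹) with hK
  have hK0 : K ≠ 0 := by simp [hK]
  by_cases hI : ∫⁻ x, f x ∂m = ∞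
  · rw [hI, ENNReal.mul_top (mul_ne_zero hK0 (ENNReal.inv_ne_zero.2 ht))]
    exact le_top
  let B (a : E × ℤ) : Set E := ball a.1 ((2 : ℝ) ^ (a.2 + 1))
  let A : Set (E × ℤ) := {a | t < ballAverage m ((2 : ℝ) ^ (a.2 + 1)) f a.1}
  have hrpos (a : E × ℤ) : (0 : ℝ) < (2 : ℝ) ^ (a.2 + 1) := by positivity
  have hA (a) (ha : a ∈ A) : t * m (B a) ≤ ∫⁻ y in B a, f y ∂m :=
    lt_mul_lintegral_of_lt_ballAverage ha
  obtain ⟨R, hR⟩ := exists_le_of_measure_ball_le (m := m) (ENNReal.div_ne_top hI ht0)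
  obtain ⟨u, huA, hdisj, hcov⟩ := Vitali.exists_disjoint_subfamily_covering_enlargement B A
    (fun a ↦ (2 : ℝ) ^ (a.2 + 1)) (3 / 2) (by norm_num) (fun a _ ↦ (hrpos a).le) R
    (fun a ha ↦ hR a.1 _ (hrpos a) (by
      rw [ENNReal.le_div_iff_mul_le (Or.inl ht0) (Or.inl ht), mul_comm]
      exact (hA a ha).trans (setLIntegral_le_lintegral _ _)))
    (fun a _ ↦ nonempty_ball.2 (hrpos a))
  have hu : u.Countable := hdisj.countable_of_isOpen (fun _ _ ↦ isOpen_ball)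
    (fun a _ ↦ nonempty_ball.2 (hrpos a))
  have hsub : {q : (ℤ → E) × E | t < shiftedMaximal m f q.1 q.2} ⊆ ⋃ a ∈ u,
      {q | ∃ k : ℕ, q.2 + q.1 (a.2 - k) ∈ ball a.1 (2 * (2 : ℝ) ^ (a.2 + 1))} := by
    rintro ⟨ω, x⟩ hq
    rw [mem_ofPred_eq, shiftedMaximal, lt_iSup_iff] at hq
    obtain ⟨j, hj⟩ := hq
    obtain ⟨a, hau, ⟨w, hw1, hw2⟩, hle⟩ := hcov (x + ω j, j) hj
    have hja : j ≤ a.2 := by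
      by_contra! hlt
      have h1 : (2 : ℝ) ^ (a.2 + 1 + 1) ≤ (2 : ℝ) ^ (j + 1) :=
        zpow_le_zpow_right₀ (by norm_num) (by omega)
      rw [zpow_add_one₀ (by norm_num)] at h1
      have h2 := hrpos a
      simp only at hle
      linarith
    have hr : (2 : ℝ) ^ (j + 1) ≤ (2 : ℝ) ^ (a.2 + 1) :=
      zpow_le_zpow_right₀ (by norm_num) (by omega)
    obtain ⟨k, hk⟩ := Int.le.dest hja
    refine mem_biUnion hau ⟨k, ?_⟩
    rw [show a.2 - (k : ℤ) = j by omega]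
    simp only [B, mem_ball] at hw1 hw2 ⊢
    calc dist (x + ω j) a.1 ≤ dist w (x + ω j) + dist w a.1 := dist_triangle_left _ _ _
      _ < 2 * (2 : ℝ) ^ (a.2 + 1) := by linarith
  have := hu.to_subtype
  calc _ ≤ ∑' a : u, (Q.prod m)
        {q | ∃ k : ℕ, q.2 + q.1 (a.1.2 - k) ∈ ball a.1.1 (2 * (2 : ℝ) ^ (a.1.2 + 1))} :=
        (measure_mono hsub).trans (measure_biUnion_le _ hu _)
    _ ≤ ∑' a : u, K * t⁻¹ * ∫⁻ y in B a, f y ∂m := by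
        refine ENNReal.tsum_le_tsum fun a ↦ ?_
        refine (measure_exists_shift_mem_ball_le (hQ a.1.2) a.1.1).trans ?_
        rw [mul_assoc, ← hK]
        gcongr
        calc m (B a) = t⁻¹ * (t * m (B a)) := by
              rw [← mul_assoc, ENNReal.inv_mul_cancel ht0 ht, one_mul]
          _ ≤ _ := by
              gcongr
              exact hA a (huA a.2)
    _ = K * t⁻¹ * ∫⁻ y in ⋃ a ∈ u, B a, f y ∂m := by
        rw [ENNReal.tsum_mul_left, lintegral_biUnion hu (fun _ _ ↦ measurableSet_ball) hdisj]
    _ ≤ _ := by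
        gcongr
        exact Measure.restrict_le_self

/-- The `L^p` bound for the dyadic maximal function with random shifts. -/
lemma lintegral_shiftedMaximal_rpow_le [Nontrivial E] {Q : Measure (ℤ → E)}
    [IsProbabilityMeasure Q] {C θ : ℝ≥0∞}
    (hQ : ∀ (n : ℤ) (k : ℕ), Q {ω | (2 : ℝ) ^ (n + 1) < ‖ω (n - k)‖} ≤ C * θ ^ k)
    {f : E → ℝ≥0∞} (hf : Measurable f) {p : ℝ} (hp : 1 < p) :
    ∫⁻ q, shiftedMaximal m f q.1 q.2 ^ p ∂(Q.prod m) ≤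
      ENNReal.ofReal p *
        ((3 ^ Module.finrank ℝ E + 2 ^ Module.finrank ℝ E * (C * (1 - θ)⁻¹)) * 2) *
        2 ^ (p - 1) / ENNReal.ofReal (p - 1) * ∫⁻ x, f x ^ p ∂m := by
  refine lintegral_rpow_le_of_measure_lt_le (measurable_shiftedMaximal hf) hf hp fun t ht ↦ ?_
  set s : Set E := {y | ENNReal.ofReal t < 2 * f y}
  have hsm : MeasurableSet s := measurableSet_lt measurable_const (by fun_prop)
  set c : ℝ≥0∞ := ENNReal.ofReal t / 2 with hc
  have hc0 : c ≠ 0 := by simp [hc, ht]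
  have hctop : c ≠ ∞ := ENNReal.div_ne_top ENNReal.ofReal_ne_top two_ne_zero
  have hfle (y : E) : f y ≤ s.indicator f y + c := by
    by_cases hy : y ∈ s
    · simp [hy]
    · rw [indicator_of_notMem hy, zero_add, hc, ENNReal.le_div_iff_mul_le (by simp) (by simp),
        mul_comm]
      exact not_lt.1 hy
  have hsub : {q : (ℤ → E) × E | ENNReal.ofReal t < shiftedMaximal m f q.1 q.2} ⊆
      {q | c < shiftedMaximal m (s.indicator f) q.1 q.2} := by
    intro q hq
    have h1 : shiftedMaximal m f q.1 q.2 ≤ shiftedMaximal m (s.indicator f) q.1 q.2 + c := by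
      refine iSup_le fun j ↦ ?_
      refine (ballAverage_mono hfle _ _).trans ((ballAverage_add_const_le _ _ _ _).trans ?_)
      gcongr
      exact le_iSup (fun j : ℤ ↦ ballAverage m ((2 : ℝ) ^ (j + 1)) (s.indicator f) (q.2 + q.1 j)) j
    have h2 : c + c < shiftedMaximal m (s.indicator f) q.1 q.2 + c := by
      rw [hc, ENNReal.add_halves]
      exact lt_of_lt_of_le hq h1
    exact lt_of_add_lt_add_right h2
  refine (measure_mono hsub).trans ((measure_lt_shiftedMaximal_le hQ _ hc0 hctop).trans_eq ?_)
  rw [lintegral_indicator hsm, hc, ENNReal.inv_div (by simp) (by simp), div_eq_mul_inv]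
  ring

/-- Averaging the shifts: an `L^p` bound for the supremum of averages of `f` convolved with
probability measures with uniformly decaying tails. -/
lemma lintegral_iSup_lintegral_ballAverage_rpow_le [Nontrivial E] {P : ℤ → Measure E}
    [∀ j, IsProbabilityMeasure (P j)] {C θ : ℝ≥0∞}
    (hP : ∀ (n : ℤ) (k : ℕ), P (n - k) {y | (2 : ℝ) ^ (n + 1) < ‖y‖} ≤ C * θ ^ k)
    {f : E → ℝ≥0∞} (hf : Measurable f) {p : ℝ} (hp : 1 < p) :
    ∫⁻ x, (⨆ j : ℤ, ∫⁻ y, ballAverage m ((2 : ℝ) ^ (j + 1)) f (x + y) ∂(P j)) ^ p ∂m ≤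
      ENNReal.ofReal p *
        ((3 ^ Module.finrank ℝ E + 2 ^ Module.finrank ℝ E * (C * (1 - θ)⁻¹)) * 2) *
        2 ^ (p - 1) / ENNReal.ofReal (p - 1) * ∫⁻ x, f x ^ p ∂m := by
  obtain ⟨Q, _, hQP⟩ : ∃ Q : Measure (ℤ → E), IsProbabilityMeasure Q ∧
      ∀ j, MeasurePreserving (fun ω ↦ ω j) Q (P j) :=
    ⟨Measure.infinitePi P, inferInstance, measurePreserving_eval_infinitePi P⟩
  have hQ (n : ℤ) (k : ℕ) : Q {ω | (2 : ℝ) ^ (n + 1) < ‖ω (n - k)‖} ≤ C * θ ^ k := by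
    have hm : MeasurableSet {y : E | (2 : ℝ) ^ (n + 1) < ‖y‖} :=
      measurableSet_lt measurable_const measurable_norm
    have h := (hQP (n - k)).measure_preimage hm.nullMeasurableSet
    exact h.le.trans (hP n k)
  have hmeas := measurable_shiftedMaximal (m := m) hf
  have hpow : Measurable fun q : (ℤ → E) × E ↦ shiftedMaximal m f q.1 q.2 ^ p :=
    hmeas.pow_const p
  have hsup (x : E) : (⨆ j : ℤ, ∫⁻ y, ballAverage m ((2 : ℝ) ^ (j + 1)) f (x + y) ∂(P j)) ^ p ≤
      ∫⁻ ω, shiftedMaximal m f ω x ^ p ∂Q := by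
    have hmx : Measurable fun ω ↦ shiftedMaximal m f ω x :=
      hmeas.comp measurable_prodMk_right
    refine le_trans ?_ (lintegral_rpow_le_lintegral_rpow hmx.aemeasurable hp)
    refine ENNReal.rpow_le_rpow (iSup_le fun j ↦ ?_) (by linarith)
    have hb : Measurable fun y ↦ ballAverage m ((2 : ℝ) ^ (j + 1)) f (x + y) :=
      (measurable_ballAverage hf _).comp (by fun_prop)
    rw [← (hQP j).lintegral_comp hb]
    exact lintegral_mono fun ω ↦
      le_iSup (fun j : ℤ ↦ ballAverage m ((2 : ℝ) ^ (j + 1)) f (x + ω j)) j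
  calc ∫⁻ x, (⨆ j : ℤ, ∫⁻ y, ballAverage m ((2 : ℝ) ^ (j + 1)) f (x + y) ∂(P j)) ^ p ∂m
      ≤ ∫⁻ x, ∫⁻ ω, shiftedMaximal m f ω x ^ p ∂Q ∂m := lintegral_mono hsup
    _ = ∫⁻ q, shiftedMaximal m f q.1 q.2 ^ p ∂(Q.prod m) := by
      rw [lintegral_prod_symm' _ hpow]
    _ ≤ _ := lintegral_shiftedMaximal_rpow_le hQ hf hp

end ShiftedMaximal

section PowerTail

variable {E : Type*} [NormedAddCommGroup E] [MeasurableSpace E] [BorelSpace E]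

lemma measurableSet_lt_norm (r : ℝ) : MeasurableSet {y : E | r < ‖y‖} :=
  measurableSet_lt measurable_const measurable_norm

/-- Two-sided power bounds on tails give uniform geometric decay of the normalized measures. -/
lemma cond_tail_le {μ : Measure E} {σ : ℝ} (hσ : 0 < σ) {c C : ℝ≥0∞}
    (hlow : ∀ r : ℝ, 0 < r → ENNReal.ofReal (r ^ (-σ)) * c ≤ μ {y | r < ‖y‖})
    (hupp : ∀ r : ℝ, 0 < r → μ {y | r < ‖y‖} ≤ ENNReal.ofReal (r ^ (-σ)) * C)
    {κ : ℝ} (hκ : κ ∈ Ioo (0 : ℝ) 1) (n : ℤ) (k : ℕ) :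
    ProbabilityTheory.cond μ {y | κ * (2 : ℝ) ^ (n - k) < ‖y‖} {y | (2 : ℝ) ^ (n + 1) < ‖y‖} ≤
      C / c * ENNReal.ofReal (2 ^ (-σ)) ^ k := by
  set a : ℝ≥0∞ := ENNReal.ofReal (((2 : ℝ) ^ (n - k)) ^ (-σ)) with ha
  have ha0 : a ≠ 0 := by
    rw [ha, ne_eq, ENNReal.ofReal_eq_zero, not_le]
    positivity
  have hatop : a ≠ ∞ := ENNReal.ofReal_ne_top
  have hpow : (((2 : ℝ) ^ n) ^ (-σ)) = ((2 : ℝ) ^ (n - k)) ^ (-σ) * (2 ^ (-σ)) ^ k := by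
    rw [Real.rpow_pow_comm (by norm_num), ← Real.mul_rpow (by positivity) (by positivity),
      ← zpow_natCast, ← zpow_add₀ (by norm_num), sub_add_cancel]
  have hlow' : a * c ≤ μ {y | κ * (2 : ℝ) ^ (n - k) < ‖y‖} := by
    refine le_trans ?_ (hlow _ (mul_pos hκ.1 (by positivity)))
    refine mul_le_mul' (ENNReal.ofReal_le_ofReal ?_) le_rfl
    refine Real.rpow_le_rpow_of_nonpos ?_ ?_ (by linarith)
    · exact mul_pos hκ.1 (by positivity)
    · exact mul_le_of_le_one_left (by positivity) hκ.2.le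
  have hupp' : μ {y | (2 : ℝ) ^ (n + 1) < ‖y‖} ≤ a * ENNReal.ofReal (2 ^ (-σ)) ^ k * C := by
    refine (hupp _ (by positivity)).trans ?_
    rw [ha, ← ENNReal.ofReal_pow (by positivity), ← ENNReal.ofReal_mul (by positivity), ← hpow]
    refine mul_le_mul' (ENNReal.ofReal_le_ofReal ?_) le_rfl
    refine Real.rpow_le_rpow_of_nonpos (by positivity) ?_ (by linarith)
    exact zpow_le_zpow_right₀ (by norm_num) (by omega)
  rw [ProbabilityTheory.cond_apply (measurableSet_lt_norm _)]
  calc _ ≤ (a * c)⁻¹ * (a * ENNReal.ofReal (2 ^ (-σ)) ^ k * C) := by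
        gcongr
        exact (measure_mono inter_subset_right).trans hupp'
    _ = a⁻¹ * a * (C / c * ENNReal.ofReal (2 ^ (-σ)) ^ k) := by
        rw [ENNReal.mul_inv (Or.inl ha0) (Or.inl hatop), div_eq_mul_inv]
        ring
    _ = _ := by rw [ENNReal.inv_mul_cancel ha0 hatop, one_mul]

variable [NormedSpace ℝ E] (m : Measure E) [m.IsAddHaarMeasure]

lemma withDensity_norm_rpow_tail_pos [Nontrivial E] (s : ℝ) :
    0 < m.withDensity (fun y ↦ ENNReal.ofReal (‖y‖ ^ s)) {y | 1 < ‖y‖} := by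
  rw [withDensity_apply _ (measurableSet_lt_norm 1), setLIntegral_pos_iff (by fun_prop)]
  have hsub : {y : E | 1 < ‖y‖} ⊆
      Function.support (fun y : E ↦ ENNReal.ofReal (‖y‖ ^ s)) ∩ {y | 1 < ‖y‖} := by
    refine fun y hy ↦ ⟨?_, hy⟩
    have hy : 1 < ‖y‖ := hy
    have : 0 < ‖y‖ := by linarith
    simp only [Function.mem_support, ne_eq, ENNReal.ofReal_eq_zero, not_le]
    positivity
  refine lt_of_lt_of_le ?_ (measure_mono hsub)
  exact (isOpen_lt continuous_const continuous_norm).measure_pos m (NormedSpace.exists_lt_norm ℝ E 1)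

variable [FiniteDimensional ℝ E]

/-- Scaling of the tails of the measure with density `‖y‖ ^ (-d - σ)`. -/
lemma withDensity_norm_rpow_tail {r : ℝ} (hr : 0 < r) (σ : ℝ) :
    m.withDensity (fun y ↦ ENNReal.ofReal (‖y‖ ^ (-(Module.finrank ℝ E : ℝ) - σ)))
        {y | r < ‖y‖} =
      ENNReal.ofReal (r ^ (-σ)) *
        m.withDensity (fun y ↦ ENNReal.ofReal (‖y‖ ^ (-(Module.finrank ℝ E : ℝ) - σ)))
          {y | 1 < ‖y‖} := by
  set d := Module.finrank ℝ E
  set g : E → ℝ≥0∞ := fun y ↦ ENNReal.ofReal (‖y‖ ^ (-(d : ℝ) - σ)) with hg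
  have hgm : Measurable g := by fun_prop
  have hscale (x : E) : {y : E | r < ‖y‖}.indicator g (r • x) =
      ENNReal.ofReal (r ^ (-(d : ℝ) - σ)) * {y : E | 1 < ‖y‖}.indicator g x := by
    have hn : ‖r • x‖ = r * ‖x‖ := by rw [norm_smul, Real.norm_of_nonneg hr.le]
    have hiff : r < ‖r • x‖ ↔ 1 < ‖x‖ := by rw [hn, lt_mul_iff_one_lt_right hr]
    by_cases hx : 1 < ‖x‖
    · rw [indicator_of_mem (by exact hiff.2 hx), indicator_of_mem (by exact hx), hg]
      simp only [hn]
      rw [Real.mul_rpow hr.le (norm_nonneg x), ENNReal.ofReal_mul (by positivity)]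
    · rw [indicator_of_notMem (by exact fun h ↦ hx (hiff.1 h)),
        indicator_of_notMem (by exact hx), mul_zero]
  have hmap := lintegral_map (μ := m) (f := {y : E | r < ‖y‖}.indicator g)
    (hgm.indicator (measurableSet_lt_norm r)) (measurable_const_smul r)
  rw [Measure.map_addHaar_smul m hr.ne', lintegral_smul_measure, abs_of_pos (by positivity)] at hmap
  simp_rw [hscale] at hmap
  rw [lintegral_const_mul _ (hgm.indicator (measurableSet_lt_norm 1)),
    lintegral_indicator (measurableSet_lt_norm r), lintegral_indicator (measurableSet_lt_norm 1),
    smul_eq_mul] at hmap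
  rw [withDensity_apply _ (measurableSet_lt_norm r), withDensity_apply _ (measurableSet_lt_norm 1)]
  calc ∫⁻ y in {y | r < ‖y‖}, g y ∂m
      = ENNReal.ofReal (r ^ d) * (ENNReal.ofReal (r ^ d)⁻¹ * ∫⁻ y in {y | r < ‖y‖}, g y ∂m) := by
        rw [← mul_assoc, ← ENNReal.ofReal_mul (by positivity), mul_inv_cancel₀ (by positivity),
          ENNReal.ofReal_one, one_mul]
    _ = _ := by
        rw [hmap, ← mul_assoc, ← ENNReal.ofReal_mul (by positivity), ← Real.rpow_natCast,
          ← Real.rpow_add hr]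
        congr 3
        ring

lemma withDensity_norm_rpow_tail_lt_top {s : ℝ} (hs : (Module.finrank ℝ E : ℝ) < s) :
    m.withDensity (fun y ↦ ENNReal.ofReal (‖y‖ ^ (-s))) {y | 1 < ‖y‖} < ∞ := by
  have hs0 : 0 < s := lt_of_le_of_lt (Nat.cast_nonneg _) hs
  rw [withDensity_apply _ (measurableSet_lt_norm 1)]
  calc ∫⁻ y in {y | 1 < ‖y‖}, ENNReal.ofReal (‖y‖ ^ (-s)) ∂m
      ≤ ∫⁻ y in {y | 1 < ‖y‖}, ENNReal.ofReal (2 ^ s) * ENNReal.ofReal ((1 + ‖y‖) ^ (-s)) ∂m := by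
        refine setLIntegral_mono' (measurableSet_lt_norm 1) fun y hy ↦ ?_
        have hy : 1 < ‖y‖ := hy
        have hy0 : 0 < ‖y‖ := by linarith
        rw [← ENNReal.ofReal_mul (by positivity)]
        refine ENNReal.ofReal_le_ofReal ?_
        calc ‖y‖ ^ (-s) = 2 ^ s * (2 * ‖y‖) ^ (-s) := by
              rw [Real.mul_rpow (by norm_num) hy0.le, ← mul_assoc, ← Real.rpow_add (by norm_num)]
              simp
          _ ≤ 2 ^ s * (1 + ‖y‖) ^ (-s) := by
              refine mul_le_mul_of_nonneg_left ?_ (by positivity)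
              exact Real.rpow_le_rpow_of_nonpos (by positivity) (by linarith) (by linarith)
    _ ≤ ∫⁻ y, ENNReal.ofReal (2 ^ s) * ENNReal.ofReal ((1 + ‖y‖) ^ (-s)) ∂m :=
        setLIntegral_le_lintegral _ _
    _ < ∞ := by
        rw [lintegral_const_mul _ (by fun_prop)]
        exact ENNReal.mul_lt_top ENNReal.ofReal_lt_top (finite_integral_one_add_norm hs)

end PowerTail

/-- `L_p`-boundedness, uniform in `κ ∈ (0,1)`, of the maximal operator
`T u = sup_j ⨍_{B_{κ2^j}^c,μ} ⨍_{B_{2^{j+1}}} |u(x+y+z)| dz dμ(y)` where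
`μ = ν + |y|^{-d-σ} dy`. -/
theorem stmt_16 (d : ℕ) (p σ Λ : ℝ) (hp : 1 < p) (hσ : σ ∈ Set.Ioo (0:ℝ) 2)
    (hΛ : 1 ≤ Λ) :
    ∃ N : ℝ, 0 < N ∧
      ∀ ν : Measure (EuclideanSpace ℝ (Fin d)),
        (∀ r : ℝ, 0 < r → ν {y | r < ‖y‖} ≤ ENNReal.ofReal (Λ * r ^ (-σ))) →
      ∀ κ : ℝ, κ ∈ Set.Ioo (0:ℝ) 1 →
      ∀ u : EuclideanSpace ℝ (Fin d) → ℝ, Measurable u →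
        (let μ : Measure (EuclideanSpace ℝ (Fin d)) :=
          ν + volume.withDensity fun y => ENNReal.ofReal (‖y‖ ^ (-(d:ℝ) - σ))
        (∫⁻ x, (⨆ j : ℤ,
            (μ {y | κ * (2:ℝ) ^ j < ‖y‖})⁻¹ *
              (volume (ball (0 : EuclideanSpace ℝ (Fin d)) ((2:ℝ) ^ (j + 1))))⁻¹ *
                ∫⁻ y in {y | κ * (2:ℝ) ^ j < ‖y‖},
                  ∫⁻ z in ball (0 : EuclideanSpace ℝ (Fin d)) ((2:ℝ) ^ (j + 1)),
                    (‖u (x + y + z)‖₊ : ℝ≥0∞) ∂volume ∂μ) ^ p) ^ (1 / p)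
          ≤ ENNReal.ofReal N * (∫⁻ x, (‖u x‖₊ : ℝ≥0∞) ^ p) ^ (1 / p)) := by
  rcases Nat.eq_zero_or_pos d with rfl | hd
  · refine ⟨1, one_pos, fun ν _ κ hκ u _ ↦ ?_⟩
    have hempty (j : ℤ) :
        {y : EuclideanSpace ℝ (Fin 0) | κ * (2 : ℝ) ^ j < ‖y‖} = ∅ := by
      ext y
      have : 0 ≤ κ * (2 : ℝ) ^ j := mul_nonneg hκ.1.le (by positivity)
      simp [Subsingleton.elim y 0, this]
    have hp0 : 0 < p := by linarith
    simp [hempty, hp0]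
  have : NeZero d := ⟨hd.ne'⟩
  have hfin : Module.finrank ℝ (EuclideanSpace ℝ (Fin d)) = d := by simp
  have : Nontrivial (EuclideanSpace ℝ (Fin d)) :=
    Module.nontrivial_of_finrank_pos (R := ℝ) (by rw [hfin]; exact hd)
  have hp0 : 0 < p := by linarith
  set w : Measure (EuclideanSpace ℝ (Fin d)) :=
    volume.withDensity fun y ↦ ENNReal.ofReal (‖y‖ ^ (-(d : ℝ) - σ))
  set c : ℝ≥0∞ := w {y | 1 < ‖y‖}
  have hc0 : c ≠ 0 := (withDensity_norm_rpow_tail_pos volume _).ne'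
  have hctop : c ≠ ∞ := by
    have h := withDensity_norm_rpow_tail_lt_top
      (volume : Measure (EuclideanSpace ℝ (Fin d))) (s := d + σ) (by rw [hfin]; linarith [hσ.1])
    rw [neg_add'] at h
    exact h.ne
  have htail (r : ℝ) (hr : 0 < r) : w {y | r < ‖y‖} = ENNReal.ofReal (r ^ (-σ)) * c := by
    have h := withDensity_norm_rpow_tail
      (volume : Measure (EuclideanSpace ℝ (Fin d))) hr σ
    rw [hfin] at h
    exact h
  set θ : ℝ≥0∞ := ENNReal.ofReal (2 ^ (-σ))
  have hθ : θ < 1 := by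
    rw [← ENNReal.ofReal_one]
    refine (ENNReal.ofReal_lt_ofReal_iff one_pos).2 ?_
    exact Real.rpow_lt_one_of_one_lt_of_neg one_lt_two (by linarith [hσ.1])
  set M : ℝ≥0∞ := ENNReal.ofReal p *
    ((3 ^ d + 2 ^ d * ((ENNReal.ofReal Λ + c) / c * (1 - θ)⁻¹)) * 2) *
    2 ^ (p - 1) / ENNReal.ofReal (p - 1) with hM
  have hMtop : M ≠ ∞ := by
    have h1 : (1 - θ)⁻¹ ≠ ∞ := ENNReal.inv_ne_top.2 (tsub_pos_of_lt hθ).ne'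
    have h2 : (ENNReal.ofReal Λ + c) / c ≠ ∞ :=
      ENNReal.div_ne_top (ENNReal.add_ne_top.2 ⟨ENNReal.ofReal_ne_top, hctop⟩) hc0
    have h3 : (2 : ℝ≥0∞) ^ (p - 1) ≠ ∞ :=
      ENNReal.rpow_ne_top_of_nonneg (by linarith) (by simp)
    have h4 : ENNReal.ofReal (p - 1) ≠ 0 := by simpa using hp
    refine ENNReal.div_ne_top (ENNReal.mul_ne_top (ENNReal.mul_ne_top ENNReal.ofReal_ne_top
      (ENNReal.mul_ne_top (ENNReal.add_ne_top.2 ⟨by simp, ?_⟩) (by simp))) h3) h4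
    exact ENNReal.mul_ne_top (by simp) (ENNReal.mul_ne_top h2 h1)
  refine ⟨(M ^ (1 / p)).toReal + 1, by positivity, fun ν hν κ hκ u hu ↦ ?_⟩
  intro μ
  have hlow (r : ℝ) (hr : 0 < r) : ENNReal.ofReal (r ^ (-σ)) * c ≤ μ {y | r < ‖y‖} := by
    rw [← htail r hr]
    exact Measure.le_add_left le_rfl _
  have hupp (r : ℝ) (hr : 0 < r) :
      μ {y | r < ‖y‖} ≤ ENNReal.ofReal (r ^ (-σ)) * (ENNReal.ofReal Λ + c) := by
    rw [mul_add, ← htail r hr, mul_comm, ← ENNReal.ofReal_mul (by linarith)]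
    exact (Measure.add_apply _ _ _).le.trans (add_le_add (hν r hr) le_rfl)
  let P (j : ℤ) : Measure (EuclideanSpace ℝ (Fin d)) :=
    ProbabilityTheory.cond μ {y | κ * (2 : ℝ) ^ j < ‖y‖}
  have hP (j : ℤ) : IsProbabilityMeasure (P j) := by
    have hr : 0 < κ * (2 : ℝ) ^ j := mul_pos hκ.1 (by positivity)
    refine ProbabilityTheory.cond_isProbabilityMeasure_of_finite ?_ ?_
    · refine (lt_of_lt_of_le (ENNReal.mul_pos ?_ hc0) (hlow _ hr)).ne'
      exact (ENNReal.ofReal_pos.2 (Real.rpow_pos_of_pos hr _)).ne'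
    · refine ((hupp _ hr).trans_lt (ENNReal.mul_lt_top ENNReal.ofReal_lt_top ?_)).ne
      exact ENNReal.add_lt_top.2 ⟨ENNReal.ofReal_lt_top, hctop.lt_top⟩
  have hf : Measurable fun x ↦ (‖u x‖₊ : ℝ≥0∞) := by fun_prop
  have hmain := lintegral_iSup_lintegral_ballAverage_rpow_le
    (m := (volume : Measure (EuclideanSpace ℝ (Fin d)))) (P := P)
    (fun n k ↦ cond_tail_le hσ.1 hlow hupp hκ n k) hf hp
  rw [hfin, ← hM] at hmain
  have hterm (j : ℤ) (x : EuclideanSpace ℝ (Fin d)) :=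
    lintegral_cond_ballAverage (m := volume) μ (r := (2 : ℝ) ^ (j + 1)) (by positivity)
      {y | κ * (2 : ℝ) ^ j < ‖y‖} (fun x ↦ (‖u x‖₊ : ℝ≥0∞)) x
  simp only [P, hterm] at hmain
  refine (ENNReal.rpow_le_rpow hmain (by positivity)).trans ?_
  rw [ENNReal.mul_rpow_of_nonneg _ _ (by positivity)]
  gcongr
  have hMp : M ^ (1 / p) ≠ ∞ := ENNReal.rpow_ne_top_of_nonneg (by positivity) hMtop
  exact (ENNReal.ofReal_toReal hMp).symm.le.trans (ENNReal.ofReal_le_ofReal (by linarith))
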